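/- For every real number d with 1 < d < 3, the solution set of the planar 4-bar closure equation with three unit links and ground length d, namely S_d = {(A, B, C) ∈ ℝ² × ℝ² × ℝ² : ‖A‖ = ‖B‖ = ‖C‖ = 1 and A + B + C = (d, 0)}, is nonempty and path-connected. (When the ground edge is longer than the unit links, the 4-bar mechanism's configuration space consists of a single connected component.) -/

import Mathlib

noncomputable section

/-- The Euclidean plane ℝ². -/
abbrev Plane := EuclideanSpace ℝ (Fin 2)

/-- The vector `(a, b)` of the Euclidean plane. -/
noncomputable def vec2 (a b : ℝ) : Plane :=
  (WithLp.equiv 2 (Fin 2 → ℝ)).symm ![a, b]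

/-- The solution set of the planar 4-bar closure equation with three unit links and
ground length `d`. -/
def fourBarSolutions (d : ℝ) : Set (Plane × Plane × Plane) :=
  {ABC | ‖ABC.1‖ = 1 ∧ ‖ABC.2.1‖ = 1 ∧ ‖ABC.2.2‖ = 1 ∧
    ABC.1 + ABC.2.1 + ABC.2.2 = vec2 d 0}

theorem mem_fourBarSolutions_iff {d : ℝ} {A B C : Plane} :
    (A, B, C) ∈ fourBarSolutions d ↔
      A 0 ^ 2 + A 1 ^ 2 = 1 ∧ B 0 ^ 2 + B 1 ^ 2 = 1 ∧ C 0 ^ 2 + C 1 ^ 2 = 1 ∧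
        A 0 + B 0 + C 0 = d ∧ A 1 + B 1 + C 1 = 0 := by
  have norm_iff (X : Plane) : ‖X‖ = 1 ↔ X 0 ^ 2 + X 1 ^ 2 = 1 := by
    simp [EuclideanSpace.norm_eq]
  have sum_iff : A + B + C = vec2 d 0 ↔ A 0 + B 0 + C 0 = d ∧ A 1 + B 1 + C 1 = 0 := by
    rw [PiLp.ext_iff, Fin.forall_fin_two]
    simp [vec2]
  simp only [fourBarSolutions, Set.mem_ofPred_eq, norm_iff, sum_iff]

/-- The configuration whose first link has angle `a` and whose elbow lies at the signed height
`s * √(1 / r ^ 2 - 1 / 4) * r` over the diagonal, `r` being the length of the diagonal. -/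
def elbowConfig (d s a : ℝ) : Plane × Plane × Plane :=
  let k := s * √(1 / (d ^ 2 + 1 - 2 * d * Real.cos a) - 1 / 4)
  (vec2 (Real.cos a) (Real.sin a),
    vec2 ((d - Real.cos a) / 2 + k * Real.sin a) (-Real.sin a / 2 + k * (d - Real.cos a)),
    vec2 ((d - Real.cos a) / 2 - k * Real.sin a) (-Real.sin a / 2 - k * (d - Real.cos a)))

theorem diagonal_sq_pos {d x : ℝ} (hd : 1 < d) (hx : x ≤ 1) : 0 < d ^ 2 + 1 - 2 * d * x := by
  nlinarith [sq_pos_of_pos (sub_pos.2 hd)]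

theorem continuous_elbowConfig {d : ℝ} (hd : 1 < d) (s : ℝ) : Continuous (elbowConfig d s) := by
  have hN (a : ℝ) : d ^ 2 + 1 - 2 * d * Real.cos a ≠ 0 :=
    (diagonal_sq_pos hd (Real.cos_le_one a)).ne'
  have hvec {f g : ℝ → ℝ} (hf : Continuous f) (hg : Continuous g) :
      Continuous fun a ↦ vec2 (f a) (g a) := by
    refine (PiLp.continuous_toLp 2 fun _ : Fin 2 ↦ ℝ).comp (continuous_pi fun i ↦ ?_)
    fin_cases i
    · simpa using hf
    · simpa using hg
  have hk : Continuous fun a ↦ s * √(1 / (d ^ 2 + 1 - 2 * d * Real.cos a) - 1 / 4) := by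
    fun_prop (disch := exact hN _)
  unfold elbowConfig
  refine (hvec (by fun_prop) (by fun_prop)).prodMk
    ((hvec ?_ ?_).prodMk (hvec ?_ ?_)) <;> fun_prop (disch := exact hN _)

theorem elbowConfig_mem {d s a : ℝ} (hd : 1 < d) (hs : s ^ 2 = 1)
    (ha : (d ^ 2 - 3) / (2 * d) ≤ Real.cos a) : elbowConfig d s a ∈ fourBarSolutions d := by
  have hN := diagonal_sq_pos hd (Real.cos_le_one a)
  rw [div_le_iff₀ (by linarith)] at ha
  have hk : √(1 / (d ^ 2 + 1 - 2 * d * Real.cos a) - 1 / 4) ^ 2 =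
      1 / (d ^ 2 + 1 - 2 * d * Real.cos a) - 1 / 4 := by
    refine Real.sq_sqrt (sub_nonneg.2 ?_)
    exact one_div_le_one_div_of_le hN (by linarith)
  have hkN : (s * √(1 / (d ^ 2 + 1 - 2 * d * Real.cos a) - 1 / 4)) ^ 2 *
      (d ^ 2 + 1 - 2 * d * Real.cos a) = 1 - (d ^ 2 + 1 - 2 * d * Real.cos a) / 4 := by
    rw [mul_pow, hs, hk, one_mul, sub_mul, one_div_mul_cancel hN.ne']
    ring
  have hsc := Real.sin_sq_add_cos_sq a
  unfold elbowConfig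
  rw [mem_fourBarSolutions_iff]
  generalize s * √(1 / (d ^ 2 + 1 - 2 * d * Real.cos a) - 1 / 4) = k at hkN
  simp only [vec2, WithLp.equiv_symm_apply, Matrix.cons_val_zero, Matrix.cons_val_one]
  refine ⟨by linarith, ?_, ?_, by ring, by ring⟩ <;>
    linear_combination hkN + (1 / 4 + k ^ 2) * hsc

theorem exists_angle {c x y : ℝ} (hxy : x ^ 2 + y ^ 2 = 1) (hx : c ≤ x) :
    ∃ a ∈ Set.Icc (-Real.arccos c) (Real.arccos c), Real.cos a = x ∧ Real.sin a = y := by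
  have hcos : Real.cos (Real.arccos x) = x :=
    Real.cos_arccos (by nlinarith [sq_nonneg y]) (by nlinarith [sq_nonneg y])
  have hsin : Real.sin (Real.arccos x) = |y| := by
    rw [Real.sin_arccos, ← Real.sqrt_sq_eq_abs]
    congr 1
    linarith
  have hle : Real.arccos x ≤ Real.arccos c := Real.arccos_le_arccos hx
  have h0 := Real.arccos_nonneg x
  rcases le_total 0 y with hy | hy
  · exact ⟨Real.arccos x, ⟨by linarith, hle⟩, hcos, by rw [hsin, abs_of_nonneg hy]⟩
  · exact ⟨-Real.arccos x, ⟨by linarith, by linarith⟩, by rw [Real.cos_neg, hcos],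
      by rw [Real.sin_neg, hsin, abs_of_nonpos hy, neg_neg]⟩

theorem exists_elbowConfig_eq {d : ℝ} (hd : 1 < d) {p : Plane × Plane × Plane}
    (hp : p ∈ fourBarSolutions d) :
    ∃ a ∈ Set.Icc (-Real.arccos ((d ^ 2 - 3) / (2 * d))) (Real.arccos ((d ^ 2 - 3) / (2 * d))),
      elbowConfig d 1 a = p ∨ elbowConfig d (-1) a = p := by
  obtain ⟨A, B, C⟩ := p
  rw [mem_fourBarSolutions_iff] at hp
  obtain ⟨hA, hB, hC, h0, h1⟩ := hp
  have e0 : C 0 = d - A 0 - B 0 := by linarith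
  have e1 : C 1 = -A 1 - B 1 := by linarith
  rw [e0, e1] at hC
  have hx : (d ^ 2 - 3) / (2 * d) ≤ A 0 := by
    rw [div_le_iff₀ (by linarith)]
    nlinarith [sq_nonneg (B 0 - (d - A 0) / 2), sq_nonneg (B 1 + A 1 / 2)]
  obtain ⟨a, ha, hcos, hsin⟩ := exists_angle hA hx
  have hN := diagonal_sq_pos hd (hcos ▸ Real.cos_le_one a : A 0 ≤ 1)
  obtain ⟨t, ht⟩ : ∃ t, t * (d ^ 2 + 1 - 2 * d * A 0) =
      (B 0 - (d - A 0) / 2) * A 1 + (B 1 + A 1 / 2) * (d - A 0) :=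
    ⟨_, div_mul_cancel₀ _ hN.ne'⟩
  have hB0 : B 0 = (d - A 0) / 2 + t * A 1 := by
    refine mul_right_cancel₀ hN.ne' ?_
    linear_combination (d - A 0) / 2 * (hB - hC) - (B 0 - (d - A 0) / 2) * hA - A 1 * ht
  have hB1 : B 1 = -A 1 / 2 + t * (d - A 0) := by
    refine mul_right_cancel₀ hN.ne' ?_
    linear_combination -A 1 / 2 * (hB - hC) - (B 1 + A 1 / 2) * hA - (d - A 0) * ht
  have ht2 : t ^ 2 = 1 / (d ^ 2 + 1 - 2 * d * A 0) - 1 / 4 := by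
    rw [hB0, hB1] at hB hC
    refine mul_right_cancel₀ hN.ne' ?_
    rw [sub_mul, one_div_mul_cancel hN.ne']
    linear_combination hB - (1 / 4 + t ^ 2) * hA
  refine ⟨a, ha, ?_⟩
  have key (s : ℝ) (h : s * √(t ^ 2) = t) : elbowConfig d s a = (A, B, C) := by
    unfold elbowConfig
    rw [hcos, hsin, ← ht2, h]
    refine Prod.ext ?_ (Prod.ext ?_ ?_) <;> ext i <;> fin_cases i <;>
      simp [vec2] <;> linarith
  rw [Real.sqrt_sq_eq_abs] at key
  rcases le_total 0 t with h | h
  · exact Or.inl (key 1 (by rw [abs_of_nonneg h, one_mul]))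
  · exact Or.inr (key (-1) (by rw [abs_of_nonpos h]; ring))

/-- For every ground length `d` with `1 < d < 3`, the configuration space of the planar
4-bar mechanism with three unit links, `S_d = {(A,B,C) : ‖A‖ = ‖B‖ = ‖C‖ = 1,
A + B + C = (d, 0)}`, is nonempty and path-connected: it consists of a single connected
component. -/
theorem fourBar_connected (d : ℝ) (hd1 : 1 < d) (hd3 : d < 3) :
    (fourBarSolutions d).Nonempty ∧ IsPathConnected (fourBarSolutions d) := by
  suffices h : IsPathConnected (fourBarSolutions d) from ⟨h.nonempty, h⟩
  set c := (d ^ 2 - 3) / (2 * d) with hc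
  have hc0 : -1 ≤ c := by rw [hc, le_div_iff₀ (by linarith)]; nlinarith
  have hc1 : c ≤ 1 := by rw [hc, div_le_iff₀ (by linarith)]; nlinarith
  have hα := Real.arccos_nonneg c
  set I := Set.Icc (-Real.arccos c) (Real.arccos c)
  have hαI : Real.arccos c ∈ I := ⟨by linarith, le_rfl⟩
  have hcosI {a : ℝ} (ha : a ∈ I) : c ≤ Real.cos a := by
    rw [← Real.cos_abs, ← Real.cos_arccos hc0 hc1]
    exact Real.cos_le_cos_of_nonneg_of_le_pi (abs_nonneg a) (Real.arccos_le_pi c) (abs_le.2 ha)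
  have hsheet (s : ℝ) : IsPathConnected (elbowConfig d s '' I) :=
    ((convex_Icc _ _).isPathConnected ⟨_, hαI⟩).image (continuous_elbowConfig hd1 s)
  have hunion : fourBarSolutions d = elbowConfig d 1 '' I ∪ elbowConfig d (-1) '' I := by
    refine Set.Subset.antisymm (fun p hp ↦ ?_) (Set.union_subset ?_ ?_)
    · obtain ⟨a, ha, h | h⟩ := exists_elbowConfig_eq hd1 hp
      · exact Or.inl ⟨a, ha, h⟩
      · exact Or.inr ⟨a, ha, h⟩
    · rintro _ ⟨a, ha, rfl⟩
      exact elbowConfig_mem hd1 (by norm_num) (hcosI ha)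
    · rintro _ ⟨a, ha, rfl⟩
      exact elbowConfig_mem hd1 (by norm_num) (hcosI ha)
  have hmeet : elbowConfig d (-1) (Real.arccos c) = elbowConfig d 1 (Real.arccos c) := by
    have hN : d ^ 2 + 1 - 2 * d * c = 4 := by
      rw [hc]
      field_simp
      ring
    simp only [elbowConfig, Real.cos_arccos hc0 hc1, hN, sub_self, Real.sqrt_zero, mul_zero]
  rw [hunion]
  exact (hsheet 1).union (hsheet (-1)) ⟨_, ⟨_, hαI, rfl⟩, ⟨_, hαI, hmeet⟩⟩
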